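/- Let H ∈ (1/2, 3/4), let Σ > 0 and let σ : [0,1] → ℝ be measurable with 0 ≤ σ(t) ≤ Σ. Let (G_t)_{t∈[0,1]} be a centered Gaussian process on a probability space (Ω, F, P) with covariance E[G_s G_t] = H(2H−1) ∫_0^s ∫_0^t σ(u) σ(v) |u − v|^{2H−2} du dv, and define the stock price S_t = S_0 exp( G_t − (1/2) E[G_t²] ) with S_0 > 0. For N ≥ 1 set σ̂²_N = N^{2H−1} Σ_{k=0}^{N−1} ( log S_{(k+1)/N} − log S_{k/N} )², c^N_{kj} = H(2H−1) ∫_{k/N}^{(k+1)/N} ∫_{j/N}^{(j+1)/N} σ(s) σ(t) |s − t|^{2H−2} dt ds, θ̃_N = N^{2H−1} Σ_{k=0}^{N−1} c^N_{kk}, and S_N = 2 N^{4H−1} Σ_{k,j} (c^N_{kj})². Assume S_N → σ²_{H,2,*} > 0 as N → ∞. Then √N ( σ̂²_N − θ̃_N ) converges in distribution to the centered normal law N(0, σ²_{H,2,*}). -/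

import Mathlib

open MeasureTheory ProbabilityTheory Filter Topology NNReal BoundedContinuousFunction

lemma integral_pow_four_stdGaussian : ∫ x, x ^ 4 ∂(gaussianReal 0 1) = 3 := by
  have h := iteratedDeriv_mgf_zero (X := id) (μ := gaussianReal 0 1)
    (by simp [integrableExpSet_id_gaussianReal]) 4
  have hd (p p' : ℝ → ℝ) (hp : ∀ t, HasDerivAt p (p' t) t) :
      deriv (fun t ↦ p t * Real.exp (t ^ 2 / 2)) =
        fun t ↦ (p' t + t * p t) * Real.exp (t ^ 2 / 2) := by
    ext t
    have he : HasDerivAt (fun t : ℝ ↦ Real.exp (t ^ 2 / 2)) (Real.exp (t ^ 2 / 2) * t) t := by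
      convert ((hasDerivAt_pow 2 t).div_const 2).exp using 1
      simp
    refine (((hp t).mul he).deriv : deriv (fun t ↦ p t * Real.exp (t ^ 2 / 2)) t = _).trans ?_
    ring
  have hpoly (a b c d : ℝ) (t : ℝ) : HasDerivAt (fun t : ℝ ↦ a + b * t + c * t ^ 2 + d * t ^ 3)
      (b + 2 * c * t + 3 * d * t ^ 2) t := by
    convert! ((((hasDerivAt_id t).const_mul b).const_add a).add
      ((hasDerivAt_pow 2 t).const_mul c)).add ((hasDerivAt_pow 3 t).const_mul d) using 1
    push_cast
    simp
    ring
  have e0 : mgf id (gaussianReal 0 1) =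
      fun t ↦ (1 + 0 * t + 0 * t ^ 2 + 0 * t ^ 3) * Real.exp (t ^ 2 / 2) := by
    rw [mgf_id_gaussianReal]
    ext t
    simp
  have e1 : deriv (mgf id (gaussianReal 0 1)) =
      fun t ↦ (0 + 1 * t + 0 * t ^ 2 + 0 * t ^ 3) * Real.exp (t ^ 2 / 2) := by
    rw [e0, hd _ _ (hpoly 1 0 0 0)]
    ext t
    ring
  have e2 : deriv (deriv (mgf id (gaussianReal 0 1))) =
      fun t ↦ (1 + 0 * t + 1 * t ^ 2 + 0 * t ^ 3) * Real.exp (t ^ 2 / 2) := by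
    rw [e1, hd _ _ (hpoly 0 1 0 0)]
    ext t
    ring
  have e3 : deriv (deriv (deriv (mgf id (gaussianReal 0 1)))) =
      fun t ↦ (0 + 3 * t + 0 * t ^ 2 + 1 * t ^ 3) * Real.exp (t ^ 2 / 2) := by
    rw [e2, hd _ _ (hpoly 1 0 1 0)]
    ext t
    ring
  rw [iteratedDeriv_succ, iteratedDeriv_succ, iteratedDeriv_succ, iteratedDeriv_one, e3,
    hd _ _ (hpoly 0 3 0 1)] at h
  simpa using h.symm

lemma integral_sq_stdGaussian : ∫ x, x ^ 2 ∂(gaussianReal 0 1) = 1 := by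
  have h := variance_eq_sub (memLp_id_gaussianReal (μ := 0) (v := 1) 2)
  simpa [variance_id_gaussianReal] using h.symm

/-- The characteristic function of `(Z² - 1) / √2` for a standard Gaussian `Z`. -/
noncomputable def charFunStdSq (t : ℝ) : ℂ :=
  charFun ((gaussianReal 0 1).map fun z : ℝ ↦ (z ^ 2 - 1) / √2) t

lemma charFunStdSq_sub_exp_isLittleO :
    (fun t : ℝ ↦ charFunStdSq t - Complex.exp (-(t : ℂ) ^ 2 / 2)) =o[𝓝 0] fun t ↦ t ^ 2 := by
  have i4 : Integrable (fun x : ℝ ↦ x ^ 4) (gaussianReal 0 1) :=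
    .of_integral_ne_zero (by simp [integral_pow_four_stdGaussian])
  have i2 : Integrable (fun x : ℝ ↦ x ^ 2) (gaussianReal 0 1) :=
    .of_integral_ne_zero (by simp [integral_sq_stdGaussian])
  have h2 : (√2 : ℝ) ^ 2 = 2 := Real.sq_sqrt (by norm_num)
  have m1 : ∫ x : ℝ, (x ^ 2 - 1) / √2 ∂(gaussianReal 0 1) = 0 := by
    rw [integral_div, integral_sub i2 (integrable_const _), integral_sq_stdGaussian]
    simp
  have m2 : ∫ x : ℝ, ((x ^ 2 - 1) / √2) ^ 2 ∂(gaussianReal 0 1) = 1 := by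
    have : (fun x : ℝ ↦ ((x ^ 2 - 1) / √2) ^ 2) = fun x ↦ (x ^ 4 - 2 * x ^ 2 + 1) / 2 := by
      ext x
      rw [div_pow, h2]
      ring
    have i42 : Integrable (fun x : ℝ ↦ x ^ 4 - 2 * x ^ 2) (gaussianReal 0 1) :=
      i4.sub (i2.const_mul 2)
    rw [this, integral_div, integral_add i42 (integrable_const _),
      integral_sub i4 (i2.const_mul 2), integral_const_mul, integral_sq_stdGaussian,
      integral_pow_four_stdGaussian]
    norm_num
  have h1 := taylor_charFun_two (P := gaussianReal 0 1) (X := fun z : ℝ ↦ (z ^ 2 - 1) / √2)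
    (by fun_prop) m1 m2
  have h3 : (fun t : ℝ ↦ Complex.exp (-(t : ℂ) ^ 2 / 2) - (1 - (t : ℂ) ^ 2 / 2))
      =o[𝓝 0] fun t ↦ t ^ 2 := by
    have hexp := (Complex.hasDerivAt_exp 0).isLittleO
    have ht : Tendsto (fun t : ℝ ↦ -(t : ℂ) ^ 2 / 2) (𝓝 0) (𝓝 0) := by
      have : Continuous (fun t : ℝ ↦ -(t : ℂ) ^ 2 / 2) := by fun_prop
      simpa using this.tendsto 0
    have := hexp.comp_tendsto ht
    refine (this.congr_left (f₂ := fun t : ℝ ↦ Complex.exp (-(t : ℂ) ^ 2 / 2) -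
      (1 - (t : ℂ) ^ 2 / 2)) ?_).trans_isBigO ?_
    · intro t
      simp
      ring
    · refine Asymptotics.IsBigO.of_bound 1 (.of_forall fun t ↦ ?_)
      simp
      nlinarith [sq_nonneg t]
  refine (h1.sub h3).congr_left fun t ↦ ?_
  simp only [charFunStdSq]
  ring

lemma charFun_map_sq_sub_gaussianReal (v : ℝ≥0) (a : ℝ) :
    charFun ((gaussianReal 0 v).map fun x : ℝ ↦ x ^ 2 - v) a = charFunStdSq (√2 * a * v) := by
  have h : gaussianReal 0 v = (gaussianReal 0 1).map (fun x ↦ √(v : ℝ) * x) := by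
    rw [gaussianReal_map_const_mul]
    congr 1
    · simp
    · ext
      simp
  have h2 : (√2 : ℝ) ≠ 0 := by positivity
  rw [h, Measure.map_map (by fun_prop) (by fun_prop), charFunStdSq]
  simp only [charFun_apply_real]
  rw [integral_map (by fun_prop) (by fun_prop), integral_map (by fun_prop) (by fun_prop)]
  congr 1 with z
  congr 2
  norm_cast
  simp only [Function.comp]
  rw [mul_pow, Real.sq_sqrt v.coe_nonneg]
  field_simp

lemma norm_prod_sub_prod_le_sum {ι : Type*} (s : Finset ι) (f g : ι → ℂ)
    (hf : ∀ i ∈ s, ‖f i‖ ≤ 1) (hg : ∀ i ∈ s, ‖g i‖ ≤ 1) :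
    ‖∏ i ∈ s, f i - ∏ i ∈ s, g i‖ ≤ ∑ i ∈ s, ‖f i - g i‖ := by
  classical
  induction s using Finset.induction_on with
  | empty => simp
  | insert i s hi ih =>
    rw [Finset.prod_insert hi, Finset.prod_insert hi, Finset.sum_insert hi]
    have ih' := ih (fun j hj ↦ hf j (Finset.mem_insert_of_mem hj))
      (fun j hj ↦ hg j (Finset.mem_insert_of_mem hj))
    have hfs : ‖∏ j ∈ s, f j‖ ≤ 1 := by
      rw [norm_prod]
      exact Finset.prod_le_one (fun _ _ ↦ norm_nonneg _)
        fun j hj ↦ hf j (Finset.mem_insert_of_mem hj)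
    calc ‖f i * ∏ j ∈ s, f j - g i * ∏ j ∈ s, g j‖
        = ‖(f i - g i) * ∏ j ∈ s, f j + g i * (∏ j ∈ s, f j - ∏ j ∈ s, g j)‖ := by ring_nf
      _ ≤ ‖f i - g i‖ * ‖∏ j ∈ s, f j‖ + ‖g i‖ * ‖∏ j ∈ s, f j - ∏ j ∈ s, g j‖ := by
        grw [norm_add_le, norm_mul, norm_mul]
      _ ≤ ‖f i - g i‖ * 1 + 1 * ∑ j ∈ s, ‖f j - g j‖ := by
        have := hg i (Finset.mem_insert_self i s)
        gcongr
      _ = _ := by ring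

lemma norm_charFun_sum_sq_sub_exp_le {ε : ℝ} (hε : 0 < ε) :
    ∃ δ > 0, ∀ {Ω ι : Type*} [MeasurableSpace Ω] [Fintype ι] {P : Measure Ω}
      [IsProbabilityMeasure P] {Y : ι → Ω → ℝ} {l : ι → ℝ≥0} {a : ℝ}, iIndepFun Y P →
      (∀ i, P.map (Y i) = gaussianReal 0 (l i)) → (∀ i, |a| * l i ≤ δ) →
      ‖charFun (P.map fun ω ↦ ∑ i, (Y i ω ^ 2 - l i)) a
        - Complex.exp (-(a : ℂ) ^ 2 * ∑ i, (l i : ℂ) ^ 2)‖ ≤ ε * a ^ 2 * ∑ i, (l i : ℝ) ^ 2 := by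
  have h := (charFunStdSq_sub_exp_isLittleO.def (half_pos hε))
  obtain ⟨r, hr, hb⟩ := Metric.eventually_nhds_iff.1 h
  refine ⟨r / 4, by positivity, ?_⟩
  intro Ω ι _ _ P _ Y l a hind hlaw hl
  have hY i : AEMeasurable (Y i) P := by
    by_contra hn
    have := hlaw i
    rw [Measure.map_of_not_aemeasurable hn] at this
    exact (IsProbabilityMeasure.ne_zero (gaussianReal 0 (l i))) this.symm
  have h2 : (√2 : ℝ) ^ 2 = 2 := Real.sq_sqrt (by norm_num)
  have hfac : charFun (P.map fun ω ↦ ∑ i, (Y i ω ^ 2 - l i)) a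
      = ∏ i, charFunStdSq (√2 * a * l i) := by
    have hind' : iIndepFun (fun i ω ↦ Y i ω ^ 2 - l i) P :=
      hind.comp (fun i x ↦ x ^ 2 - l i) (fun i ↦ by fun_prop)
    rw [hind'.charFun_map_fun_sum_eq_prod (fun i ↦ by fun_prop), Finset.prod_apply]
    refine Finset.prod_congr rfl fun i _ ↦ ?_
    rw [← charFun_map_sq_sub_gaussianReal, ← hlaw i, AEMeasurable.map_map_of_aemeasurable
      (by fun_prop) (hY i)]
    rfl
  have hexp : Complex.exp (-(a : ℂ) ^ 2 * ∑ i, (l i : ℂ) ^ 2)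
      = ∏ i, Complex.exp (-((√2 * a * l i : ℝ) : ℂ) ^ 2 / 2) := by
    rw [← Complex.exp_sum, Finset.mul_sum]
    congr 1
    refine Finset.sum_congr rfl fun i _ ↦ ?_
    rw [show ((l i : ℂ)) = (((l i : ℝ)) : ℂ) from rfl]
    norm_cast
    rw [mul_pow, mul_pow, h2]
    push_cast
    ring
  rw [hfac, hexp, Finset.mul_sum]
  refine (norm_prod_sub_prod_le_sum _ _ _ ?_ ?_).trans (Finset.sum_le_sum fun i _ ↦ ?_)
  · intro i _
    have : IsProbabilityMeasure ((gaussianReal 0 1).map fun z : ℝ ↦ (z ^ 2 - 1) / √2) :=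
      Measure.isProbabilityMeasure_map (by fun_prop)
    exact norm_charFun_le_one _
  · intro i _
    rw [show -((√2 * a * l i : ℝ) : ℂ) ^ 2 / 2 = ((-(√2 * a * l i) ^ 2 / 2 : ℝ) : ℂ) by
      push_cast; ring, Complex.norm_exp_ofReal, Real.exp_le_one_iff]
    nlinarith [sq_nonneg (√2 * a * l i)]
  · have hdist : dist (√2 * a * l i) 0 < r := by
      rw [dist_zero_right, norm_mul, norm_mul, Real.norm_eq_abs, Real.norm_eq_abs,
        Real.norm_eq_abs, abs_of_nonneg (Real.sqrt_nonneg 2), abs_of_nonneg (l i).coe_nonneg,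
        mul_assoc]
      have h3 : √2 ≤ 2 := by nlinarith [Real.sqrt_nonneg 2]
      have h4 : 0 ≤ |a| * l i := by positivity
      nlinarith [hl i]
    refine (hb hdist).trans (le_of_eq ?_)
    rw [Real.norm_eq_abs, abs_of_nonneg (sq_nonneg _), mul_pow, mul_pow, h2]
    ring

lemma exists_orthogonal_diagonalization {ι : Type*} [Fintype ι] [DecidableEq ι]
    {C : Matrix ι ι ℝ} (hC : C.IsHermitian) :
    ∃ (U : Matrix ι ι ℝ) (d : ι → ℝ), U.transpose * U = 1 ∧ U * U.transpose = 1 ∧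
      U.transpose * C * U = Matrix.diagonal d ∧
      ∀ i, ∃ k, |d i| ≤ ∑ j, |C k j| := by
  have hU := hC.eigenvectorUnitary.2
  rw [Matrix.mem_unitaryGroup_iff] at hU
  have hU' := Matrix.mem_unitaryGroup_iff'.1 hC.eigenvectorUnitary.2
  rw [Matrix.star_eq_conjTranspose, Matrix.conjTranspose_eq_transpose_of_trivial] at hU hU'
  refine ⟨hC.eigenvectorUnitary, hC.eigenvalues, hU', hU, ?_, fun i ↦ ?_⟩
  · have := hC.conjStarAlgAut_star_eigenvectorUnitary
    rw [Unitary.conjStarAlgAut_apply] at this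
    simpa [Matrix.star_eq_conjTranspose, Matrix.conjTranspose_eq_transpose_of_trivial,
      Function.comp_def] using this
  · have hev : Module.End.HasEigenvalue (Matrix.toLin' C) (hC.eigenvalues i) := by
      refine Module.End.hasEigenvalue_of_hasEigenvector
        (x := (hC.eigenvectorBasis i : ι → ℝ)) ⟨?_, ?_⟩
      · rw [Module.End.mem_eigenspace_iff, Matrix.toLin'_apply, hC.mulVec_eigenvectorBasis]
      · intro h0
        refine hC.eigenvectorBasis.toBasis.ne_zero i ?_
        ext j
        simpa using congrFun h0 j
    obtain ⟨k, hk⟩ := eigenvalue_mem_ball hev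
    refine ⟨k, ?_⟩
    rw [Metric.mem_closedBall, Real.dist_eq] at hk
    rw [← Finset.add_sum_erase _ _ (Finset.mem_univ k)]
    simp only [Real.norm_eq_abs] at hk
    have := abs_add_le (hC.eigenvalues i - C k k) (C k k)
    rw [sub_add_cancel] at this
    linarith

/-- The centered quadratic form of a Gaussian vector with small covariance rows is close to a
Gaussian variable with the same variance. -/
lemma norm_charFun_sum_sq_gaussian_sub_exp_le {ε : ℝ} (hε : 0 < ε) :
    ∃ δ > 0, ∀ {Ω ι : Type*} [MeasurableSpace Ω] [Fintype ι] {P : Measure Ω}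
      [IsProbabilityMeasure P] {X : ι → Ω → ℝ} {C : ι → ι → ℝ} {a : ℝ},
      HasGaussianLaw (fun ω k ↦ X k ω) P → (∀ k, ∫ ω, X k ω ∂P = 0) →
      (∀ k j, ∫ ω, X k ω * X j ω ∂P = C k j) → (∀ k, |a| * ∑ j, |C k j| ≤ δ) →
      ‖charFun (P.map fun ω ↦ ∑ i, (X i ω ^ 2 - C i i)) a
        - Complex.exp ((-a ^ 2 * ∑ i, ∑ j, C i j ^ 2 : ℝ))‖
        ≤ ε * a ^ 2 * ∑ i, ∑ j, C i j ^ 2 := by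
  obtain ⟨δ, hδ, H⟩ := norm_charFun_sum_sq_sub_exp_le hε
  refine ⟨δ, hδ, ?_⟩
  intro Ω ι _ _ P _ X C a hX h0 hcov hrow
  classical
  have hC : (Matrix.of C).IsHermitian := by
    ext i j
    simp only [Matrix.conjTranspose_apply, Matrix.of_apply, star_trivial]
    rw [← hcov, ← hcov]
    simp_rw [mul_comm]
  obtain ⟨U, d, hU1, hU2, hd, hdle⟩ := exists_orthogonal_diagonalization hC
  have hXL k : MemLp (X k) 2 P := (hX.eval k).memLp_two
  set Y : ι → Ω → ℝ := fun i ω ↦ ∑ k, U k i * X k ω with hYdef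
  have hYg : HasGaussianLaw (fun ω i ↦ Y i ω) P := by
    have := hX.map_fun (Matrix.mulVecLin U.transpose).toContinuousLinearMap
    convert! this using 3
  have hY0 i : ∫ ω, Y i ω ∂P = 0 := by
    simp only [hYdef]
    rw [integral_finsetSum _ fun k _ ↦ ((hXL k).integrable one_le_two).const_mul _]
    simp [integral_const_mul, h0]
  have hYL i : MemLp (Y i) 2 P := (hYg.eval i).memLp_two
  have hYY i j : ∫ ω, Y i ω * Y j ω ∂P = Matrix.diagonal d i j := by
    rw [← hd]
    simp only [hYdef, Finset.sum_mul_sum]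
    have hint k l : Integrable (fun ω ↦ U k i * X k ω * (U l j * X l ω)) P := by
      have := ((hXL k).integrable_mul (hXL l)).const_mul (U k i * U l j)
      refine this.congr (.of_forall fun ω ↦ ?_)
      simp only [Pi.mul_apply]
      ring
    rw [integral_finsetSum _ fun k _ ↦ integrable_finsetSum _ fun l _ ↦ hint k l]
    simp_rw [Matrix.mul_apply, Finset.sum_mul]
    rw [Finset.sum_comm]
    refine Finset.sum_congr rfl fun k _ ↦ ?_
    rw [integral_finsetSum _ fun l _ ↦ hint k l]
    refine Finset.sum_congr rfl fun l _ ↦ ?_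
    rw [Matrix.transpose_apply, Matrix.of_apply, ← hcov, ← integral_const_mul,
      ← integral_mul_const]
    congr 1 with ω
    ring
  have hYcov i j : cov[Y i, Y j; P] = Matrix.diagonal d i j := by
    rw [covariance_eq_sub (hYL i) (hYL j), hY0, hY0, ← hYY]
    simp
  have hind : iIndepFun Y P := hYg.iIndepFun_of_covariance_eq_zero fun i j hij ↦ by
    rw [hYcov, Matrix.diagonal_apply_ne _ hij]
  have hdnn i : 0 ≤ d i := by
    rw [← Matrix.diagonal_apply_eq d i, ← hYY]
    exact integral_nonneg fun ω ↦ mul_self_nonneg _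
  lift d to ι → ℝ≥0 using hdnn
  have hlaw i : P.map (Y i) = gaussianReal 0 (d i) := by
    rw [(hYg.eval i).map_eq_gaussianReal, hY0, ← covariance_self (hYL i).aemeasurable, hYcov]
    simp
  have key := H (a := a) hind hlaw fun i ↦ by
    obtain ⟨k, hk⟩ := hdle i
    refine le_trans ?_ (hrow k)
    gcongr
    simpa using hk
  have hsq : ∑ i, (d i : ℝ) ^ 2 = ∑ i, ∑ j, C i j ^ 2 := by
    have h1 : (Matrix.of C * Matrix.of C).trace = ∑ i, ∑ j, C i j ^ 2 := by
      simp only [Matrix.trace, Matrix.diag_apply, Matrix.mul_apply, Matrix.of_apply]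
      refine Finset.sum_congr rfl fun i _ ↦ Finset.sum_congr rfl fun j _ ↦ ?_
      rw [sq, ← hcov i j, ← hcov j i]
      simp_rw [mul_comm (X j _)]
    have h2 : (Matrix.diagonal (fun i ↦ (d i : ℝ)) * Matrix.diagonal fun i ↦ (d i : ℝ)).trace
        = ∑ i, (d i : ℝ) ^ 2 := by
      simp [Matrix.diagonal_mul_diagonal, Matrix.trace_diagonal, sq]
    rw [← h1, ← h2, ← hd]
    calc _ = (U.transpose * (Matrix.of C * (U * U.transpose) * Matrix.of C * U)).trace := by
          simp only [Matrix.mul_assoc]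
      _ = _ := by
          rw [hU2, Matrix.trace_mul_comm]
          simp only [Matrix.mul_assoc, Matrix.mul_one, hU2]
  have htr : ∑ i, (d i : ℝ) = ∑ i, C i i := by
    have h2 : (Matrix.diagonal (fun i ↦ (d i : ℝ))).trace = ∑ i, (d i : ℝ) := by
      simp [Matrix.trace_diagonal]
    rw [← h2, ← hd, Matrix.trace_mul_comm, ← Matrix.mul_assoc, hU2, Matrix.one_mul]
    simp [Matrix.trace]
  have hsumsq ω : ∑ i, Y i ω ^ 2 = ∑ i, X i ω ^ 2 := by
    have h1 : ∑ i, Y i ω ^ 2 = (U.transpose.mulVec fun k ↦ X k ω) ⬝ᵥ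
        (U.transpose.mulVec fun k ↦ X k ω) := by
      simp [hYdef, dotProduct, Matrix.mulVec, sq]
    rw [h1, Matrix.dotProduct_mulVec, Matrix.vecMul_transpose, Matrix.mulVec_mulVec, hU2]
    simp [dotProduct, sq]
  have hF : (fun ω ↦ ∑ i, (Y i ω ^ 2 - d i)) = fun ω ↦ ∑ i, (X i ω ^ 2 - C i i) := by
    ext ω
    rw [Finset.sum_sub_distrib, Finset.sum_sub_distrib, hsumsq, htr]
  rw [hF, hsq] at key
  convert key using 4
  rw [← hsq]
  push_cast
  rfl

section Kernel

variable {β Λ : ℝ} {σ : ℝ → ℝ}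

lemma intervalIntegrable_abs_rpow (hβ : -1 < β) (a b : ℝ) :
    IntervalIntegrable (fun x : ℝ ↦ |x| ^ β) volume a b := by
  have hpos (c : ℝ) (hc : 0 ≤ c) : IntervalIntegrable (fun x : ℝ ↦ |x| ^ β) volume 0 c := by
    refine (intervalIntegral.intervalIntegrable_rpow' hβ).congr_ae ?_
    refine (ae_restrict_mem measurableSet_uIoc).mono fun x hx ↦ ?_
    rw [Set.uIoc_of_le hc] at hx
    simp [abs_of_pos hx.1]
  have h0 (c : ℝ) : IntervalIntegrable (fun x : ℝ ↦ |x| ^ β) volume 0 c := by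
    rcases le_total 0 c with hc | hc
    · exact hpos c hc
    · have := (IntervalIntegrable.iff_comp_neg (f := fun x : ℝ ↦ |x| ^ β)).1
        (hpos (-c) (by linarith))
      simpa using this
  exact (h0 a).symm.trans (h0 b)

lemma intervalIntegrable_kernel (hβ : -1 < β) (hσ : Measurable σ)
    (hσbd : ∀ t ∈ Set.Icc (0 : ℝ) 1, 0 ≤ σ t ∧ σ t ≤ Λ) (u : ℝ) {a b : ℝ}
    (ha : a ∈ Set.Icc (0 : ℝ) 1) (hb : b ∈ Set.Icc (0 : ℝ) 1) :
    IntervalIntegrable (fun v ↦ σ u * σ v * |u - v| ^ β) volume a b := by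
  have h1 : IntervalIntegrable (fun v ↦ |u - v| ^ β) volume a b := by
    simpa using (intervalIntegrable_abs_rpow hβ (u - a) (u - b)).comp_sub_left u
  refine (h1.const_mul (|σ u| * Λ)).mono_fun (by fun_prop) ?_
  refine (ae_restrict_mem measurableSet_uIoc).mono fun v hv ↦ ?_
  have hv' : v ∈ Set.Icc (0 : ℝ) 1 := (Set.uIcc_subset_Icc ha hb) (Set.uIoc_subset_uIcc hv)
  obtain ⟨h0, h1⟩ := hσbd v hv'
  have h2 : 0 ≤ |u - v| ^ β := by positivity
  simp only [Real.norm_eq_abs, abs_mul, abs_abs, abs_of_nonneg h2, abs_of_nonneg h0]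
  rw [abs_of_nonneg (h0.trans h1)]
  gcongr

lemma integral_kernel_nonneg_and_le (hβ : -1 < β) (hσ : Measurable σ)
    (hσbd : ∀ t ∈ Set.Icc (0 : ℝ) 1, 0 ≤ σ t ∧ σ t ≤ Λ) {u a b : ℝ}
    (hu : u ∈ Set.Icc (0 : ℝ) 1) (ha : 0 ≤ a) (hab : a ≤ b) (hb : b ≤ 1) :
    0 ≤ ∫ v in a..b, σ u * σ v * |u - v| ^ β ∧
      ∫ v in a..b, σ u * σ v * |u - v| ^ β ≤ Λ ^ 2 * ∫ x in (-1 : ℝ)..1, |x| ^ β := by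
  have hsub {v : ℝ} (hv : v ∈ Set.Icc a b) : v ∈ Set.Icc (0 : ℝ) 1 :=
    ⟨ha.trans hv.1, hv.2.trans hb⟩
  obtain ⟨hu0, hu1⟩ := hσbd u hu
  constructor
  · refine intervalIntegral.integral_nonneg hab fun v hv ↦ ?_
    have := (hσbd v (hsub hv)).1
    positivity
  · calc ∫ v in a..b, σ u * σ v * |u - v| ^ β
        ≤ ∫ v in a..b, Λ ^ 2 * |u - v| ^ β := by
          refine intervalIntegral.integral_mono_on hab
            (intervalIntegrable_kernel hβ hσ hσbd u ⟨ha, hab.trans hb⟩ ⟨ha.trans hab, hb⟩) ?_ ?_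
          · simpa using
              ((intervalIntegrable_abs_rpow hβ (u - a) (u - b)).comp_sub_left u).const_mul (Λ ^ 2)
          · intro v hv
            obtain ⟨hv0, hv1⟩ := hσbd v (hsub hv)
            rw [sq]
            gcongr
            exact hu0.trans hu1
      _ = Λ ^ 2 * ∫ x in (u - b)..(u - a), |x| ^ β := by
          rw [intervalIntegral.integral_const_mul,
            intervalIntegral.integral_comp_sub_left (fun x ↦ |x| ^ β) u]
      _ ≤ Λ ^ 2 * ∫ x in (-1 : ℝ)..1, |x| ^ β := by
          gcongr
          refine intervalIntegral.integral_mono_interval (by linarith [hu.1]) (by linarith)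
            (by linarith [hu.2]) (.of_forall fun x ↦ ?_) (intervalIntegrable_abs_rpow hβ _ _)
          simp only [Pi.zero_apply]
          positivity

lemma intervalIntegrable_integral_kernel (hβ : -1 < β) (hσ : Measurable σ)
    (hσbd : ∀ t ∈ Set.Icc (0 : ℝ) 1, 0 ≤ σ t ∧ σ t ≤ Λ) {a b s t : ℝ}
    (ha : 0 ≤ a) (hab : a ≤ b) (hb : b ≤ 1)
    (hs : s ∈ Set.Icc (0 : ℝ) 1) (ht : t ∈ Set.Icc (0 : ℝ) 1) :
    IntervalIntegrable (fun u ↦ ∫ v in a..b, σ u * σ v * |u - v| ^ β) volume s t := by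
  have hm : StronglyMeasurable fun u ↦ ∫ v in a..b, σ u * σ v * |u - v| ^ β := by
    simp_rw [intervalIntegral.integral_of_le hab]
    have hm2 : Measurable fun p : ℝ × ℝ ↦ σ p.1 * σ p.2 * |p.1 - p.2| ^ β := by fun_prop
    exact hm2.stronglyMeasurable.integral_prod_right
  refine (intervalIntegrable_const (c := Λ ^ 2 * ∫ x in (-1 : ℝ)..1, |x| ^ β)).mono_fun
    hm.aestronglyMeasurable ?_
  refine (ae_restrict_mem measurableSet_uIoc).mono fun u hu ↦ ?_
  have hu' : u ∈ Set.Icc (0 : ℝ) 1 := (Set.uIcc_subset_Icc hs ht) (Set.uIoc_subset_uIcc hu)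
  obtain ⟨h0, h1⟩ := integral_kernel_nonneg_and_le hβ hσ hσbd hu' ha hab hb
  simpa only [Real.norm_eq_abs, abs_of_nonneg h0, abs_of_nonneg (h0.trans h1)] using h1

lemma integral_integral_kernel_nonneg_and_le (hβ : -1 < β) (hσ : Measurable σ)
    (hσbd : ∀ t ∈ Set.Icc (0 : ℝ) 1, 0 ≤ σ t ∧ σ t ≤ Λ) {a b s t : ℝ}
    (ha : 0 ≤ a) (hab : a ≤ b) (hb : b ≤ 1) (hs : 0 ≤ s) (hst : s ≤ t) (ht : t ≤ 1) :
    0 ≤ ∫ u in s..t, ∫ v in a..b, σ u * σ v * |u - v| ^ β ∧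
      ∫ u in s..t, ∫ v in a..b, σ u * σ v * |u - v| ^ β ≤
        (Λ ^ 2 * ∫ x in (-1 : ℝ)..1, |x| ^ β) * (t - s) := by
  have hsub {u : ℝ} (hu : u ∈ Set.Icc s t) : u ∈ Set.Icc (0 : ℝ) 1 :=
    ⟨hs.trans hu.1, hu.2.trans ht⟩
  constructor
  · exact intervalIntegral.integral_nonneg hst fun u hu ↦
      (integral_kernel_nonneg_and_le hβ hσ hσbd (hsub hu) ha hab hb).1
  · refine (intervalIntegral.integral_mono_on hst
      (intervalIntegrable_integral_kernel hβ hσ hσbd ha hab hb ⟨hs, hst.trans ht⟩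
        ⟨hs.trans hst, ht⟩) (intervalIntegrable_const
          (c := Λ ^ 2 * ∫ x in (-1 : ℝ)..1, |x| ^ β)) fun u hu ↦
      (integral_kernel_nonneg_and_le hβ hσ hσbd (hsub hu) ha hab hb).2).trans (le_of_eq ?_)
    rw [intervalIntegral.integral_const, smul_eq_mul, mul_comm]

lemma integral_integral_kernel_left_sub (hβ : -1 < β) (hσ : Measurable σ)
    (hσbd : ∀ t ∈ Set.Icc (0 : ℝ) 1, 0 ≤ σ t ∧ σ t ≤ Λ) {a b s t : ℝ}
    (ha : 0 ≤ a) (hab : a ≤ b) (hb : b ≤ 1) (hs : 0 ≤ s) (hst : s ≤ t) (ht : t ≤ 1) :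
    ∫ u in s..t, ∫ v in a..b, σ u * σ v * |u - v| ^ β =
      (∫ u in (0 : ℝ)..t, ∫ v in a..b, σ u * σ v * |u - v| ^ β) -
        ∫ u in (0 : ℝ)..s, ∫ v in a..b, σ u * σ v * |u - v| ^ β := by
  have h0 : (0 : ℝ) ∈ Set.Icc (0 : ℝ) 1 := by simp
  rw [intervalIntegral.integral_interval_sub_left
    (intervalIntegrable_integral_kernel hβ hσ hσbd ha hab hb h0 ⟨hs.trans hst, ht⟩)
    (intervalIntegrable_integral_kernel hβ hσ hσbd ha hab hb h0 ⟨hs, hst.trans ht⟩)]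

lemma integral_integral_kernel_right_sub (hβ : -1 < β) (hσ : Measurable σ)
    (hσbd : ∀ t ∈ Set.Icc (0 : ℝ) 1, 0 ≤ σ t ∧ σ t ≤ Λ) {a b s t : ℝ}
    (ha : 0 ≤ a) (hab : a ≤ b) (hb : b ≤ 1) (hs : 0 ≤ s) (hst : s ≤ t) (ht : t ≤ 1) :
    ∫ u in s..t, ∫ v in a..b, σ u * σ v * |u - v| ^ β =
      (∫ u in s..t, ∫ v in (0 : ℝ)..b, σ u * σ v * |u - v| ^ β) -
        ∫ u in s..t, ∫ v in (0 : ℝ)..a, σ u * σ v * |u - v| ^ β := by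
  have h0 : (0 : ℝ) ∈ Set.Icc (0 : ℝ) 1 := by simp
  have hs' : s ∈ Set.Icc (0 : ℝ) 1 := ⟨hs, hst.trans ht⟩
  have ht' : t ∈ Set.Icc (0 : ℝ) 1 := ⟨hs.trans hst, ht⟩
  rw [← intervalIntegral.integral_sub
    (intervalIntegrable_integral_kernel hβ hσ hσbd le_rfl (ha.trans hab) hb hs' ht')
    (intervalIntegrable_integral_kernel hβ hσ hσbd le_rfl ha (hab.trans hb) hs' ht')]
  congr 1 with u
  rw [intervalIntegral.integral_interval_sub_left
    (intervalIntegrable_kernel hβ hσ hσbd u h0 ⟨ha.trans hab, hb⟩)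
    (intervalIntegrable_kernel hβ hσ hσbd u h0 ⟨ha, hab.trans hb⟩)]

end Kernel

section GaussianArray

variable {Ω : Type*} [MeasurableSpace Ω] {P : Measure Ω}

lemma tendstoInMeasure_zero_of_tendsto_integral_sq {f : ℕ → Ω → ℝ} (hf : ∀ n, MemLp (f n) 2 P)
    (h : Tendsto (fun n ↦ ∫ ω, f n ω ^ 2 ∂P) atTop (𝓝 0)) :
    TendstoInMeasure P f atTop (fun _ ↦ 0) := by
  refine tendstoInMeasure_of_tendsto_eLpNorm (p := 2) (by simp) (fun n ↦ (hf n).1)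
    aestronglyMeasurable_const ?_
  have h1 n : eLpNorm (f n - fun _ ↦ 0) 2 P = ENNReal.ofReal (√(∫ ω, f n ω ^ 2 ∂P)) := by
    rw [show (f n - fun _ ↦ 0) = f n by ext; simp,
      (hf n).eLpNorm_eq_integral_rpow_norm (by simp) (by simp), Real.sqrt_eq_rpow]
    simp
  simp_rw [h1]
  simpa using ENNReal.tendsto_ofReal (h.sqrt)

lemma integral_sq_sum_mul {ι : Type*} [Fintype ι] {X : ι → Ω → ℝ} {C : ι → ι → ℝ}
    (hX : ∀ k, MemLp (X k) 2 P) (hC : ∀ k j, ∫ ω, X k ω * X j ω ∂P = C k j) (d : ι → ℝ) :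
    ∫ ω, (∑ k, d k * X k ω) ^ 2 ∂P = ∑ k, ∑ j, d k * d j * C k j := by
  have hint k l : Integrable (fun ω ↦ d k * X k ω * (d l * X l ω)) P := by
    refine (((hX k).integrable_mul (hX l)).const_mul (d k * d l)).congr (.of_forall fun ω ↦ ?_)
    simp only [Pi.mul_apply]
    ring
  simp_rw [sq, Finset.sum_mul_sum]
  rw [integral_finsetSum _ fun k _ ↦ integrable_finsetSum _ fun l _ ↦ hint k l]
  refine Finset.sum_congr rfl fun k _ ↦ ?_
  rw [integral_finsetSum _ fun l _ ↦ hint k l]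
  refine Finset.sum_congr rfl fun l _ ↦ ?_
  rw [← hC, ← integral_const_mul]
  congr 1 with ω
  ring

variable [IsProbabilityMeasure P] {X : ∀ N : ℕ, Fin N → Ω → ℝ} {C : ∀ N : ℕ, Fin N → Fin N → ℝ} {b : ℕ → ℝ} {A : ℝ}
  {v : ℝ≥0}

/-- Central limit theorem for the quadratic variation of a triangular Gaussian array. -/
lemma tendstoInDistribution_sum_sq_gaussian
    (hX : ∀ N, HasGaussianLaw (fun ω k ↦ X N k ω) P) (hX0 : ∀ N k, ∫ ω, X N k ω ∂P = 0)
    (hC : ∀ N k j, ∫ ω, X N k ω * X N j ω ∂P = C N k j)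
    (hrow : ∀ N k, ∑ j, |C N k j| ≤ A / N) (hb : Tendsto (fun N ↦ b N / N) atTop (𝓝 0))
    (hlim : Tendsto (fun N ↦ 2 * b N ^ 2 * ∑ k, ∑ j, C N k j ^ 2) atTop (𝓝 (v : ℝ))) :
    TendstoInDistribution (fun N ω ↦ b N * ∑ k, (X N k ω ^ 2 - C N k k)) atTop (id : ℝ → ℝ)
      (fun _ ↦ P) (gaussianReal 0 v) where
  forall_aemeasurable N := by
    have (k : Fin N) : AEMeasurable (X N k) P := ((hX N).eval k).aemeasurable
    fun_prop
  tendsto := by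
    refine ProbabilityMeasure.tendsto_iff_tendsto_charFun.2 fun t ↦ ?_
    simp only [ProbabilityMeasure.coe_mk, Measure.map_id]
    have hm N : AEMeasurable (fun ω ↦ ∑ k, (X N k ω ^ 2 - C N k k)) P := by
      have (k : Fin N) : AEMeasurable (X N k) P := ((hX N).eval k).aemeasurable
      fun_prop
    simp_rw [fun N ↦ charFun_map_mul_comp (hm N) (b N) t]
    set V : ℕ → ℝ := fun N ↦ 2 * b N ^ 2 * ∑ k, ∑ j, C N k j ^ 2 with hV
    have hexp : Tendsto (fun N ↦ Complex.exp ((-(b N * t) ^ 2 * ∑ k, ∑ j, C N k j ^ 2 : ℝ)))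
        atTop (𝓝 (charFun (gaussianReal 0 v) t)) := by
      have h1 : Tendsto (fun N ↦ Complex.exp ((-(t ^ 2 / 2) * V N : ℝ))) atTop
          (𝓝 (Complex.exp ((-(t ^ 2 / 2) * v : ℝ)))) :=
        (Complex.continuous_exp.tendsto _).comp
          ((Complex.continuous_ofReal.tendsto _).comp (hlim.const_mul _))
      convert h1 using 2
      · simp only [hV]
        congr 2
        ring
      · rw [charFun_gaussianReal]
        push_cast
        congr 1
        simp
        ring
    suffices h : Tendsto (fun N ↦ charFun (P.map fun ω ↦ ∑ k, (X N k ω ^ 2 - C N k k)) (b N * t)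
        - Complex.exp ((-(b N * t) ^ 2 * ∑ k, ∑ j, C N k j ^ 2 : ℝ))) atTop (𝓝 0) by
      simpa using h.add hexp
    rw [Metric.tendsto_nhds]
    intro ε hε
    set M : ℝ := t ^ 2 * (v + 1) + 1
    have hM : 0 < M := by positivity
    obtain ⟨δ, hδ, H⟩ := norm_charFun_sum_sq_gaussian_sub_exp_le (div_pos hε hM)
    have hVle : ∀ᶠ N in atTop, V N ≤ v + 1 := hlim.eventually_le_const (by linarith)
    have hsmall : ∀ᶠ N in atTop, |A * t * (b N / N)| < δ := by
      have := (hb.const_mul (A * t)).abs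
      simp only [mul_zero, abs_zero] at this
      exact this.eventually_lt_const hδ
    filter_upwards [hVle, hsmall] with N h1 h2
    rw [dist_zero_right]
    have h3 : ‖_‖ ≤ ε / M * (b N * t) ^ 2 * ∑ i, ∑ j, C N i j ^ 2 :=
      H (a := b N * t) (hX N) (hX0 N) (hC N) fun k ↦ by
        have hAN : 0 ≤ A / N := (Finset.sum_nonneg fun j _ ↦ abs_nonneg _).trans (hrow N k)
        calc |b N * t| * ∑ j, |C N k j| ≤ |b N * t| * (A / N) := by
              gcongr
              exact hrow N k
          _ = |A * t * (b N / N)| := by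
              rw [← abs_of_nonneg hAN, ← abs_mul]
              congr 1
              ring
          _ ≤ δ := h2.le
    refine h3.trans_lt ?_
    calc ε / M * (b N * t) ^ 2 * ∑ i, ∑ j, C N i j ^ 2 = ε / M * (t ^ 2 / 2 * V N) := by
          simp only [hV]
          ring
      _ ≤ ε / M * (t ^ 2 / 2 * (v + 1)) := by gcongr
      _ < ε / M * M := by
          gcongr
          have : 0 ≤ t ^ 2 * ((v : ℝ) + 1) := by positivity
          simp only [M]
          linarith
      _ = ε := by field_simp

/-- The central limit theorem is insensitive to a drift of order `1 / N` in the increments. -/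
lemma tendstoInDistribution_sum_sq_sub_drift {d : ∀ N : ℕ, Fin N → ℝ}
    (hX : ∀ N, HasGaussianLaw (fun ω k ↦ X N k ω) P) (hX0 : ∀ N k, ∫ ω, X N k ω ∂P = 0)
    (hC : ∀ N k j, ∫ ω, X N k ω * X N j ω ∂P = C N k j)
    (hrow : ∀ N k, ∑ j, |C N k j| ≤ A / N) (hd : ∀ N k, |d N k| ≤ A / N)
    (hb : Tendsto (fun N ↦ b N / N) atTop (𝓝 0))
    (hlim : Tendsto (fun N ↦ 2 * b N ^ 2 * ∑ k, ∑ j, C N k j ^ 2) atTop (𝓝 (v : ℝ))) :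
    TendstoInDistribution (fun N ω ↦ b N * ∑ k, ((X N k ω - d N k) ^ 2 - C N k k)) atTop
      (id : ℝ → ℝ) (fun _ ↦ P) (gaussianReal 0 v) := by
  have hXL N k : MemLp (X N k) 2 P := ((hX N).eval k).memLp_two
  set L : ℕ → Ω → ℝ := fun N ω ↦ ∑ k, d N k * X N k ω with hL
  set q : ℕ → ℝ := fun N ↦ b N * ∑ k, d N k ^ 2 with hq
  have hLL N : MemLp (L N) 2 P := by
    simpa only [hL] using memLp_finsetSum Finset.univ fun k _ ↦ (hXL N k).const_mul (d N k)
  have hA : ∀ N, |q N| ≤ A ^ 2 * |b N / N| := by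
    intro N
    rcases eq_or_ne N 0 with rfl | hN
    · simp [hq]
    have hN' : (0 : ℝ) < N := by positivity
    calc |q N| = |b N| * ∑ k, d N k ^ 2 := by
          have hs : 0 ≤ ∑ k, d N k ^ 2 := Finset.sum_nonneg fun k _ ↦ sq_nonneg _
          simp only [hq]
          rw [abs_mul, abs_of_nonneg hs]
      _ ≤ |b N| * ∑ k : Fin N, (A / N) ^ 2 := by
          refine mul_le_mul_of_nonneg_left (Finset.sum_le_sum fun k _ ↦ ?_) (abs_nonneg _)
          rw [← sq_abs]
          exact pow_le_pow_left₀ (abs_nonneg _) (hd N k) 2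
      _ = _ := by
          rw [abs_div, abs_of_pos hN']
          simp
          field_simp
  have hq0 : Tendsto q atTop (𝓝 0) := by
    refine squeeze_zero_norm hA ?_
    simpa using hb.abs.const_mul (A ^ 2)
  have hL0 : Tendsto (fun N ↦ b N ^ 2 * ∫ ω, L N ω ^ 2 ∂P) atTop (𝓝 0) := by
    refine squeeze_zero (g := fun N ↦ A ^ 3 * (b N / N) ^ 2)
      (fun N ↦ mul_nonneg (sq_nonneg _) (integral_nonneg fun ω ↦ sq_nonneg _)) (fun N ↦ ?_) ?_
    · rcases eq_or_ne N 0 with rfl | hN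
      · simp [hL]
      have hN' : (0 : ℝ) < N := by positivity
      simp only [hL]
      rw [integral_sq_sum_mul (hXL N) (hC N)]
      calc b N ^ 2 * ∑ k, ∑ j, d N k * d N j * C N k j
          ≤ b N ^ 2 * ∑ k : Fin N, (A / N) ^ 2 * (A / N) := by
            gcongr with k
            calc ∑ j, d N k * d N j * C N k j ≤ ∑ j, (A / N) ^ 2 * |C N k j| := by
                  refine Finset.sum_le_sum fun j _ ↦ (le_abs_self _).trans ?_
                  rw [abs_mul, abs_mul, sq]
                  have := (abs_nonneg _).trans (hd N k)
                  gcongr <;> apply hd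
              _ ≤ _ := by
                  rw [← Finset.mul_sum]
                  gcongr
                  exact hrow N k
        _ = _ := by
          simp
          field_simp
    · simpa using (hb.pow 2).const_mul (A ^ 3)
  have hmeas : TendstoInMeasure P (fun N ω ↦ -2 * b N * L N ω + q N) atTop fun _ ↦ (0 : ℝ) := by
    refine tendstoInMeasure_zero_of_tendsto_integral_sq
      (fun N ↦ ((hLL N).const_mul (-2 * b N)).add (memLp_const (q N))) ?_
    have hexpand N : ∫ ω, (-2 * b N * L N ω + q N) ^ 2 ∂P
        = 4 * (b N ^ 2 * ∫ ω, L N ω ^ 2 ∂P) + q N ^ 2 := by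
      have hLi : ∫ ω, L N ω ∂P = 0 := by
        simp only [hL]
        rw [integral_finsetSum _ fun k _ ↦ ((hXL N k).integrable one_le_two).const_mul _]
        simp [integral_const_mul, hX0]
      have i1 : Integrable (fun ω ↦ 4 * b N ^ 2 * L N ω ^ 2) P := (hLL N).integrable_sq.const_mul _
      have i2 : Integrable (fun ω ↦ -4 * b N * q N * L N ω) P :=
        ((hLL N).integrable one_le_two).const_mul _
      have : (fun ω ↦ (-2 * b N * L N ω + q N) ^ 2) =
          fun ω ↦ 4 * b N ^ 2 * L N ω ^ 2 + -4 * b N * q N * L N ω + q N ^ 2 := by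
        ext ω
        ring
      rw [this, integral_add (by exact i1.add i2) (integrable_const _), integral_add i1 i2,
        integral_const_mul, integral_const_mul, hLi]
      simp
      ring
    simp_rw [hexpand]
    simpa using (hL0.const_mul 4).add (hq0.pow 2)
  have hmain := (tendstoInDistribution_sum_sq_gaussian hX hX0 hC hrow hb
    hlim).add_of_tendstoInMeasure_const hmeas fun N ↦
      (((hLL N).const_mul (-2 * b N)).add (memLp_const (q N))).1.aemeasurable
  have hid : (fun x : ℝ ↦ id x + 0) = id := by
    ext
    simp
  rw [hid] at hmain
  convert! hmain using 3 with N ω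
  simp only [Pi.add_apply, hL, hq, Finset.mul_sum, ← Finset.sum_add_distrib]
  refine Finset.sum_congr rfl fun k _ ↦ ?_
  ring

end GaussianArray

section GaussianProcess

variable {Ω : Type*} [MeasurableSpace Ω] {P : Measure Ω}

lemma hasGaussianLaw_of_forall_sum {ι : Type*} [Fintype ι] {Y : ι → Ω → ℝ}
    (h : ∀ a : ι → ℝ, ∃ v : ℝ≥0, P.map (fun ω ↦ ∑ i, a i * Y i ω) = gaussianReal 0 v) :
    HasGaussianLaw (fun ω i ↦ Y i ω) P ∧ ∀ i, ∫ ω, Y i ω ∂P = 0 := by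
  classical
  have hY i : AEMeasurable (Y i) P ∧ ∃ v : ℝ≥0, P.map (Y i) = gaussianReal 0 v := by
    obtain ⟨v, hv⟩ := h (Pi.single i 1)
    simp only [Pi.single_apply, ite_mul, one_mul, zero_mul, Finset.sum_ite_eq',
      Finset.mem_univ, if_true] at hv
    refine ⟨?_, v, hv⟩
    by_contra hne
    rw [Measure.map_of_not_aemeasurable hne] at hv
    exact IsProbabilityMeasure.ne_zero (gaussianReal 0 v) hv.symm
  have hYm : AEMeasurable (fun ω i ↦ Y i ω) P := aemeasurable_pi_lambda _ fun i ↦ (hY i).1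
  refine ⟨⟨isGaussian_of_map_eq_gaussianReal fun L ↦ ?_⟩, fun i ↦ ?_⟩
  · obtain ⟨v, hv⟩ := h fun i ↦ L (Pi.single i 1)
    refine ⟨0, v, ?_⟩
    rw [AEMeasurable.map_map_of_aemeasurable (by fun_prop) hYm, ← hv]
    congr 1
    ext ω
    simp only [Function.comp_apply]
    conv_lhs => rw [← Finset.univ_sum_single fun i ↦ Y i ω, map_sum]
    refine Finset.sum_congr rfl fun i _ ↦ ?_
    rw [mul_comm, ← smul_eq_mul, ← map_smul]
    congr 1
    ext j
    simp [Pi.single_apply]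
  · obtain ⟨hm, v, hv⟩ := hY i
    have := integral_map (f := id) hm aestronglyMeasurable_id
    rw [hv] at this
    simpa using this.symm

variable {β Λ K : ℝ} {σ : ℝ → ℝ} {G : ℝ → Ω → ℝ}

lemma integral_increment_mul_increment (hβ : -1 < β) (hσ : Measurable σ)
    (hσbd : ∀ t ∈ Set.Icc (0 : ℝ) 1, 0 ≤ σ t ∧ σ t ≤ Λ)
    (hG : ∀ t ∈ Set.Icc (0 : ℝ) 1, MemLp (G t) 2 P)
    (hcov : ∀ s t : ℝ, s ∈ Set.Icc (0 : ℝ) 1 → t ∈ Set.Icc (0 : ℝ) 1 →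
      ∫ ω, G s ω * G t ω ∂P =
        K * ∫ u in (0 : ℝ)..s, ∫ v in (0 : ℝ)..t, σ u * σ v * |u - v| ^ β) {a b s t : ℝ}
    (ha : 0 ≤ a) (hab : a ≤ b) (hb : b ≤ 1) (hs : 0 ≤ s) (hst : s ≤ t) (ht : t ≤ 1) :
    ∫ ω, (G t ω - G s ω) * (G b ω - G a ω) ∂P =
      K * ∫ u in s..t, ∫ v in a..b, σ u * σ v * |u - v| ^ β := by
  have ha' : a ∈ Set.Icc (0 : ℝ) 1 := ⟨ha, hab.trans hb⟩
  have hb' : b ∈ Set.Icc (0 : ℝ) 1 := ⟨ha.trans hab, hb⟩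
  have hs' : s ∈ Set.Icc (0 : ℝ) 1 := ⟨hs, hst.trans ht⟩
  have ht' : t ∈ Set.Icc (0 : ℝ) 1 := ⟨hs.trans hst, ht⟩
  have hi {x y : ℝ} (hx : x ∈ Set.Icc (0 : ℝ) 1) (hy : y ∈ Set.Icc (0 : ℝ) 1) :
      Integrable (fun ω ↦ G x ω * G y ω) P := (hG x hx).integrable_mul (hG y hy)
  have hexp : (fun ω ↦ (G t ω - G s ω) * (G b ω - G a ω)) = fun ω ↦
      (G t ω * G b ω - G t ω * G a ω) - (G s ω * G b ω - G s ω * G a ω) := by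
    ext ω
    ring
  rw [hexp, integral_sub (by exact (hi ht' hb').sub (hi ht' ha'))
    (by exact (hi hs' hb').sub (hi hs' ha')), integral_sub (hi ht' hb') (hi ht' ha'),
    integral_sub (hi hs' hb') (hi hs' ha'), hcov _ _ ht' hb', hcov _ _ ht' ha', hcov _ _ hs' hb',
    hcov _ _ hs' ha', integral_integral_kernel_right_sub hβ hσ hσbd ha hab hb hs hst ht,
    integral_integral_kernel_left_sub hβ hσ hσbd le_rfl (ha.trans hab) hb hs hst ht,
    integral_integral_kernel_left_sub hβ hσ hσbd le_rfl ha (hab.trans hb) hs hst ht]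
  ring

lemma abs_integral_sq_sub_integral_sq_le (hβ : -1 < β) (hσ : Measurable σ)
    (hσbd : ∀ t ∈ Set.Icc (0 : ℝ) 1, 0 ≤ σ t ∧ σ t ≤ Λ) (hK : 0 ≤ K)
    (hcov : ∀ s t : ℝ, s ∈ Set.Icc (0 : ℝ) 1 → t ∈ Set.Icc (0 : ℝ) 1 →
      ∫ ω, G s ω * G t ω ∂P =
        K * ∫ u in (0 : ℝ)..s, ∫ v in (0 : ℝ)..t, σ u * σ v * |u - v| ^ β) {s t : ℝ}
    (hs : 0 ≤ s) (hst : s ≤ t) (ht : t ≤ 1) :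
    |∫ ω, G t ω ^ 2 ∂P - ∫ ω, G s ω ^ 2 ∂P| ≤
      2 * (K * (Λ ^ 2 * ∫ x in (-1 : ℝ)..1, |x| ^ β) * (t - s)) := by
  have hs' : s ∈ Set.Icc (0 : ℝ) 1 := ⟨hs, hst.trans ht⟩
  have ht' : t ∈ Set.Icc (0 : ℝ) 1 := ⟨hs.trans hst, ht⟩
  have hsymm : ∫ ω, G s ω * G t ω ∂P = ∫ ω, G t ω * G s ω ∂P := by simp_rw [mul_comm]
  have h1 := integral_integral_kernel_left_sub hβ hσ hσbd le_rfl (hs.trans hst) ht hs hst ht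
  have h2 := integral_integral_kernel_left_sub hβ hσ hσbd le_rfl hs (hst.trans ht) hs hst ht
  have h3 := integral_integral_kernel_nonneg_and_le hβ hσ hσbd le_rfl (hs.trans hst) ht hs hst ht
  have h4 := integral_integral_kernel_nonneg_and_le hβ hσ hσbd le_rfl hs (hst.trans ht) hs hst ht
  have heq : ∫ ω, G t ω ^ 2 ∂P - ∫ ω, G s ω ^ 2 ∂P =
      K * (∫ u in s..t, ∫ v in (0 : ℝ)..t, σ u * σ v * |u - v| ^ β) +
        K * ∫ u in s..t, ∫ v in (0 : ℝ)..s, σ u * σ v * |u - v| ^ β := by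
    simp_rw [sq]
    rw [h1, h2, mul_sub, mul_sub, ← hcov _ _ ht' ht', ← hcov _ _ hs' ht', ← hcov _ _ ht' hs',
      ← hcov _ _ hs' hs', hsymm]
    ring
  have h5 := mul_le_mul_of_nonneg_left h3.2 hK
  have h6 := mul_le_mul_of_nonneg_left h4.2 hK
  rw [heq, abs_of_nonneg (add_nonneg (mul_nonneg hK h3.1) (mul_nonneg hK h4.1))]
  linarith

lemma natCast_div_mem_Icc {k N : ℕ} (h : k ≤ N) : (k : ℝ) / N ∈ Set.Icc (0 : ℝ) 1 :=
  ⟨by positivity, div_le_one_of_le₀ (by exact_mod_cast h) (by positivity)⟩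

lemma sum_integral_integral_kernel_le (hβ : -1 < β) (hσ : Measurable σ)
    (hσbd : ∀ t ∈ Set.Icc (0 : ℝ) 1, 0 ≤ σ t ∧ σ t ≤ Λ) (N : ℕ) {s t : ℝ}
    (hs : 0 ≤ s) (hst : s ≤ t) (ht : t ≤ 1) :
    ∑ j ∈ Finset.range N, (∫ u in s..t, ∫ v in ((j : ℝ) / N)..(((j : ℝ) + 1) / N),
      σ u * σ v * |u - v| ^ β) ≤ (Λ ^ 2 * ∫ x in (-1 : ℝ)..1, |x| ^ β) * (t - s) := by
  set F : ℕ → ℝ := fun j ↦ ∫ u in s..t, ∫ v in (0 : ℝ)..((j : ℝ) / N), σ u * σ v * |u - v| ^ β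
    with hF
  have hN := natCast_div_mem_Icc (le_refl N)
  have h0 := natCast_div_mem_Icc (Nat.zero_le N)
  have hsum : ∑ j ∈ Finset.range N, (∫ u in s..t, ∫ v in ((j : ℝ) / N)..(((j : ℝ) + 1) / N),
      σ u * σ v * |u - v| ^ β) = F N - F 0 := by
    rw [← Finset.sum_range_sub]
    refine Finset.sum_congr rfl fun j hj ↦ ?_
    have h2 := natCast_div_mem_Icc (Finset.mem_range.1 hj)
    simp only [hF]
    rw [integral_integral_kernel_right_sub hβ hσ hσbd (by positivity) (by gcongr; linarith)
      (by simpa using h2.2) hs hst ht]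
    push_cast
    rfl
  rw [hsum]
  have h1 := (integral_integral_kernel_nonneg_and_le hβ hσ hσbd le_rfl hN.1 hN.2 hs hst ht).2
  have h2 := (integral_integral_kernel_nonneg_and_le hβ hσ hσbd le_rfl h0.1 h0.2 hs hst ht).1
  simp only [hF]
  linarith

end GaussianProcess

lemma tendsto_sqrt_mul_rpow_div_atTop {H : ℝ} (hH : H < 3 / 4) :
    Tendsto (fun N : ℕ ↦ √N * (N : ℝ) ^ (2 * H - 1) / N) atTop (𝓝 0) := by
  have h := (tendsto_rpow_neg_atTop (y := 3 / 2 - 2 * H) (by linarith)).comp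
    tendsto_natCast_atTop_atTop
  refine h.congr' ?_
  filter_upwards [eventually_gt_atTop 0] with N hN
  have hN' : (0 : ℝ) < N := by exact_mod_cast hN
  rw [Function.comp_apply, Real.sqrt_eq_rpow, ← Real.rpow_add hN', ← Real.rpow_sub_one hN'.ne']
  congr 1
  ring

/-- CLT for the quadratic-variation estimator under time-varying
volatility: √N(σ̂²_N − θ̃_N) ⇒ N(0, σ²_{H,2,*}). -/
theorem clt_estimator_time_varying_vol
    {Ω : Type*} [MeasurableSpace Ω] (P : Measure Ω) [IsProbabilityMeasure P]
    (H : ℝ) (hH : H ∈ Set.Ioo (1/2 : ℝ) (3/4))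
    (Λ : ℝ) (hΛ : 0 < Λ)
    (σ : ℝ → ℝ) (hσmeas : Measurable σ)
    (hσbd : ∀ t ∈ Set.Icc (0:ℝ) 1, 0 ≤ σ t ∧ σ t ≤ Λ)
    -- the centered Gaussian process G on [0,1]
    (G : ℝ → Ω → ℝ)
    (hGauss : ∀ (n : ℕ) (a : Fin n → ℝ) (t : Fin n → ℝ),
      (∀ i, t i ∈ Set.Icc (0:ℝ) 1) →
      ∃ v : ℝ≥0, P.map (fun ω => ∑ i, a i * G (t i) ω) = gaussianReal 0 v)
    (hGCov : ∀ s t : ℝ, s ∈ Set.Icc (0:ℝ) 1 → t ∈ Set.Icc (0:ℝ) 1 →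
      ∫ ω, G s ω * G t ω ∂P = H * (2*H - 1) *
        ∫ u in (0:ℝ)..s, ∫ v in (0:ℝ)..t, σ u * σ v * |u - v| ^ (2*H - 2))
    -- the stock price S_t = S₀ exp(G_t − ½ E[G_t²])
    (S₀ : ℝ) (hS₀ : 0 < S₀)
    (S : ℝ → Ω → ℝ)
    (hS : ∀ t ω, S t ω = S₀ * Real.exp (G t ω - (1/2) * ∫ ω', (G t ω')^2 ∂P))
    -- the quadratic-variation estimator
    (σhat : ℕ → Ω → ℝ)
    (hσhat : ∀ (N : ℕ) (ω : Ω), σhat N ω = (N : ℝ) ^ (2*H - 1) *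
      ∑ k ∈ Finset.range N,
        (Real.log (S (((k : ℝ) + 1)/N) ω) - Real.log (S ((k : ℝ)/N) ω))^2)
    -- covariance matrix, centering constants, variances
    (c : ℕ → ℕ → ℕ → ℝ)
    (hc : ∀ N k j : ℕ, c N k j = H * (2*H - 1) *
      ∫ s in ((k : ℝ)/N)..(((k : ℝ) + 1)/N),
        ∫ t in ((j : ℝ)/N)..(((j : ℝ) + 1)/N), σ s * σ t * |s - t| ^ (2*H - 2))
    (θ : ℕ → ℝ)
    (hθ : ∀ N : ℕ, θ N = (N : ℝ) ^ (2*H - 1) * ∑ k ∈ Finset.range N, c N k k)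
    (S' : ℕ → ℝ)
    (hS' : ∀ N : ℕ, S' N = 2 * (N : ℝ) ^ (4*H - 1) *
      ∑ k ∈ Finset.range N, ∑ j ∈ Finset.range N, (c N k j)^2)
    (v : ℝ≥0) (hv : 0 < v)
    (hlim : Tendsto S' atTop (𝓝 (v : ℝ))) :
    -- conclusion: √N(σ̂²_N − θ̃_N) ⇒ N(0, σ²_{H,2,*})
    ∀ f : ℝ →ᵇ ℝ,
      Tendsto (fun N : ℕ => ∫ ω, f (Real.sqrt N * (σhat N ω - θ N)) ∂P)
        atTop (𝓝 (∫ x, f x ∂(gaussianReal 0 v))) := by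
  have hβ : -1 < 2 * H - 2 := by linarith [hH.1]
  have hK : 0 ≤ H * (2 * H - 1) := mul_nonneg (by linarith [hH.1]) (by linarith [hH.1])
  set A : ℝ := H * (2 * H - 1) * (Λ ^ 2 * ∫ x in (-1 : ℝ)..1, |x| ^ (2 * H - 2)) with hA
  have hGL t (ht : t ∈ Set.Icc (0 : ℝ) 1) : MemLp (G t) 2 P :=
    ((hasGaussianLaw_of_forall_sum (Y := fun _ : Fin 1 ↦ G t) fun a ↦
      hGauss 1 a (fun _ ↦ t) fun _ ↦ ht).1.eval 0).memLp_two
  have hl {N k : ℕ} (hk : k < N) : 0 ≤ (k : ℝ) / N := by positivity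
  have hm {N k : ℕ} (hk : k < N) : (k : ℝ) / N ≤ ((k : ℝ) + 1) / N := by gcongr; linarith
  have hr {N k : ℕ} (hk : k < N) : ((k : ℝ) + 1) / N ≤ 1 := by
    simpa using (natCast_div_mem_Icc hk).2
  have hlen (N k : ℕ) : ((k : ℝ) + 1) / N - k / N = 1 / N := by ring
  set X : ∀ N : ℕ, Fin N → Ω → ℝ := fun N k ω ↦ G (((k : ℝ) + 1) / N) ω - G ((k : ℝ) / N) ω
    with hXdef
  have hX (N : ℕ) : HasGaussianLaw (fun ω k ↦ X N k ω) P ∧ ∀ k, ∫ ω, X N k ω ∂P = 0 := by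
    refine hasGaussianLaw_of_forall_sum fun a ↦ ?_
    obtain ⟨w, hw⟩ := hGauss (N + N) (Fin.append a (-a))
      (Fin.append (fun k ↦ ((k : ℝ) + 1) / N) fun k ↦ (k : ℝ) / N) fun i ↦ by
        refine Fin.addCases (fun k ↦ ?_) (fun k ↦ ?_) i
        · rw [Fin.append_left]
          exact ⟨(hl k.2).trans (hm k.2), hr k.2⟩
        · rw [Fin.append_right]
          exact ⟨hl k.2, (hm k.2).trans (hr k.2)⟩
    refine ⟨w, hw ▸ ?_⟩
    congr 1
    ext ω
    rw [Fin.sum_univ_add, ← Finset.sum_add_distrib]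
    refine Finset.sum_congr rfl fun k _ ↦ ?_
    simp only [hXdef, Fin.append_left, Fin.append_right, Pi.neg_apply]
    ring
  have hXX N (k j : Fin N) : ∫ ω, X N k ω * X N j ω ∂P = c N k j := by
    rw [hc]
    exact integral_increment_mul_increment hβ hσmeas hσbd hGL hGCov (hl j.2) (hm j.2) (hr j.2)
      (hl k.2) (hm k.2) (hr k.2)
  have hrow N (k : Fin N) : ∑ j : Fin N, |c N k j| ≤ A / N := by
    have hnn (j : Fin N) : 0 ≤ c N k j := by
      rw [hc]
      exact mul_nonneg hK (integral_integral_kernel_nonneg_and_le hβ hσmeas hσbd (hl j.2) (hm j.2)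
        (hr j.2) (hl k.2) (hm k.2) (hr k.2)).1
    have hsum := mul_le_mul_of_nonneg_left (sum_integral_integral_kernel_le hβ hσmeas hσbd N
      (hl k.2) (hm k.2) (hr k.2)) hK
    rw [hlen, Finset.mul_sum, ← mul_assoc, ← hA, mul_one_div] at hsum
    refine le_trans (le_of_eq ?_) hsum
    rw [Finset.sum_range]
    exact Finset.sum_congr rfl fun j _ ↦ by rw [abs_of_nonneg (hnn j), hc]
  set d : ∀ N : ℕ, Fin N → ℝ := fun N k ↦
    (∫ ω, G (((k : ℝ) + 1) / N) ω ^ 2 ∂P - ∫ ω, G ((k : ℝ) / N) ω ^ 2 ∂P) / 2 with hd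
  have hdA N (k : Fin N) : |d N k| ≤ A / N := by
    have := abs_integral_sq_sub_integral_sq_le hβ hσmeas hσbd hK hGCov (hl k.2) (hm k.2) (hr k.2)
    rw [hlen, ← hA, mul_one_div] at this
    simp only [hd]
    rw [abs_div, abs_two]
    linarith
  have hbS (N : ℕ) : S' N = 2 * (√N * (N : ℝ) ^ (2 * H - 1)) ^ 2 *
      ∑ k : Fin N, ∑ j : Fin N, c N k j ^ 2 := by
    rcases Nat.eq_zero_or_pos N with rfl | hN
    · simp [hS']
    have hN' : (0 : ℝ) < N := by exact_mod_cast hN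
    rw [hS', Finset.sum_range]
    simp_rw [Finset.sum_range]
    congr 2
    rw [mul_pow, Real.sq_sqrt hN'.le, ← Real.rpow_natCast, ← Real.rpow_mul hN'.le]
    nth_rw 2 [← Real.rpow_one (N : ℝ)]
    rw [← Real.rpow_add hN']
    congr 1
    push_cast
    ring
  have hlog t ω : Real.log (S t ω) =
      Real.log S₀ + (G t ω - (1 / 2) * ∫ ω', G t ω' ^ 2 ∂P) := by
    rw [hS, Real.log_mul hS₀.ne' (Real.exp_ne_zero _), Real.log_exp]
  have hest (N : ℕ) (ω : Ω) : √N * (σhat N ω - θ N) =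
      √N * (N : ℝ) ^ (2 * H - 1) * ∑ k : Fin N, ((X N k ω - d N k) ^ 2 - c N k k) := by
    rw [hσhat, hθ, ← mul_sub, ← Finset.sum_sub_distrib, Finset.sum_range, ← mul_assoc]
    congr 1
    refine Finset.sum_congr rfl fun k _ ↦ ?_
    simp only [hlog, hXdef, hd]
    ring
  have hconv := tendstoInDistribution_sum_sq_sub_drift (v := v) (fun N ↦ (hX N).1)
    (fun N ↦ (hX N).2) hXX hrow hdA (tendsto_sqrt_mul_rpow_div_atTop hH.2)
    (hlim.congr hbS)
  intro f
  have hlimf := ProbabilityMeasure.tendsto_iff_forall_integral_tendsto.1 hconv.tendsto f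
  simp only [ProbabilityMeasure.coe_mk, Measure.map_id] at hlimf
  refine hlimf.congr fun N ↦ ?_
  rw [integral_map (hconv.forall_aemeasurable N) f.continuous.aestronglyMeasurable]
  simp_rw [hest]
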